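/- Every greedy-like non-clairvoyant online algorithm is Ω(√n)-competitive: there is a constant c > 0 such that for every greedy-like algorithm A and infinitely many n, there exists an instance with n jobs (with setup time s = 1) on which the maximum flow time of A is at least c·√n times the optimal maximum flow time. -/

import Mathlib

open Finset MeasureTheory ProbabilityTheory

attribute [local instance] Classical.propDecidable

/-- The position directly preceding position `i` (equal to `i` when `i = 0`). -/
def prevFin {n : ℕ} (i : Fin n) : Fin n :=
  ⟨i.val - 1, Nat.lt_of_le_of_lt (Nat.pred_le _) i.isLt⟩

/-- An instance of the scheduling problem with `n` jobs: each job `j` has a release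
time `r j ≥ 0`, a processing time `p j` and a type `τ j`; switching between types
requires a setup taking `s ≥ 0` time units. -/
structure SInstance (n : ℕ) where
  r : Fin n → ℝ
  p : Fin n → ℝ
  τ : Fin n → ℕ
  s : ℝ
  hr : ∀ j, 0 ≤ r j
  hs : 0 ≤ s

namespace SInstance

variable {n : ℕ}

/-- The multiplicatively perturbed instance with processing times `(1 + x j) * p j`. -/
def perturb (I : SInstance n) (x : Fin n → ℝ) : SInstance n :=
  { I with p := fun j => (1 + x j) * I.p j }

/-- Total processing time of the jobs satisfying `P` (e.g. released in some interval). -/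
noncomputable def workloadIn (I : SInstance n) (P : Fin n → Prop) : ℝ :=
  ∑ j : Fin n, if P j then I.p j else 0

/-- The smallest release time. -/
noncomputable def rmin (I : SInstance n) : ℝ := sInf (Set.range I.r)

/-- The largest release time. -/
noncomputable def rmax (I : SInstance n) : ℝ := sSup (Set.range I.r)

end SInstance

/-- A feasible non-preemptive single machine schedule: `π i` is the job processed
`i`-th and `t j` is the start time of job `j`.  A job starts no earlier than its
release time, a setup of `s` time units precedes the first job, and between two
consecutive jobs of different types a setup of `s` time units must take place. -/
structure Schedule {n : ℕ} (I : SInstance n) where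
  π : Fin n ≃ Fin n
  t : Fin n → ℝ
  h_release : ∀ j, I.r j ≤ t j
  h_first : ∀ h : 0 < n, I.s ≤ t (π ⟨0, h⟩)
  h_gap : ∀ i : Fin n, 0 < i.val →
    t (π (prevFin i)) + I.p (π (prevFin i)) +
      (if I.τ (π (prevFin i)) ≠ I.τ (π i) then I.s else 0) ≤ t (π i)

namespace Schedule

variable {n : ℕ} {I : SInstance n}

/-- Completion time of job `j`. -/
def c (S : Schedule I) (j : Fin n) : ℝ := S.t j + I.p j

/-- Flow time of job `j`. -/
def flow (S : Schedule I) (j : Fin n) : ℝ := S.c j - I.r j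

/-- Maximum flow time of the schedule. -/
noncomputable def maxFlow (S : Schedule I) : ℝ := sSup (Set.range S.flow)

/-- A schedule is optimal if it minimizes the maximum flow time. -/
def IsOptimal (S : Schedule I) : Prop := ∀ S' : Schedule I, S.maxFlow ≤ S'.maxFlow

/-- The overhead (setup plus idle time) directly preceding the job processed at
position `i`, i.e. the overhead associated to this job. -/
def overheadAt (S : Schedule I) (i : Fin n) : ℝ :=
  if 0 < i.val then S.t (S.π i) - S.c (S.π (prevFin i)) else S.t (S.π i)

/-- The job at position `i` starts a batch (it is the first job processed, or its
type differs from that of the previously processed job). -/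
def startsBatch (S : Schedule I) (i : Fin n) : Prop :=
  i.val = 0 ∨ I.τ (S.π (prevFin i)) ≠ I.τ (S.π i)

/-- The positions `a, …, b` form a batch: all these jobs have a common type, and the
batch is maximal. -/
def IsBatch (S : Schedule I) (a b : Fin n) : Prop :=
  a ≤ b ∧ (∀ m : Fin n, a ≤ m → m ≤ b → I.τ (S.π m) = I.τ (S.π a)) ∧
  S.startsBatch a ∧
  ∀ h : b.val + 1 < n, I.τ (S.π ⟨b.val + 1, h⟩) ≠ I.τ (S.π b)

/-- The overhead occurring in schedule `S` between the start of the first-started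
and the start of the last-started among the jobs satisfying `P` (e.g. the jobs
released in some interval): the length of this time window minus the processing
performed within it. -/
noncomputable def overheadOn (S : Schedule I) (P : Fin n → Prop) : ℝ :=
  if h : (Finset.univ.filter P).Nonempty then
    ((Finset.univ.filter P).sup' h S.t - (Finset.univ.filter P).inf' h S.t)
      - ∑ j : Fin n,
          if (Finset.univ.filter P).inf' h S.t ≤ S.t j ∧
             S.t j < (Finset.univ.filter P).sup' h S.t then I.p j else 0
  else 0

end Schedule

/-- A run of the algorithm BALANCE (with `α = 13`) on instance `I`.  `lam j` is the
value of the balance parameter λ when job `j` was scheduled and `dec j` is the time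
at which the idling machine selected job `j` (the job then starts after a setup if
needed).  The fields express: λ is a power of α starting at α and it is multiplied
by α as soon as a job completes with flow time ≥ αλ; the machine never idles
deliberately; and whenever a job is selected, it minimizes the adjusted release
time `r̄` among the already released, still unscheduled jobs (`r̄ j = r j` if `τ j`
is the type the machine is configured for, i.e. the type of the previous job, and
`r̄ j = r j + λ` otherwise), ties being broken in favor of the active type. -/
structure BalanceSchedule {n : ℕ} (I : SInstance n) extends Schedule I where
  lam : Fin n → ℝ
  dec : Fin n → ℝ
  h_lam_pow : ∀ j, ∃ q : ℕ, lam j = 13 ^ q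
  h_lam_init : ∀ h : 0 < n, lam (toSchedule.π ⟨0, h⟩) = 13
  h_lam_mono : ∀ i : Fin n, 0 < i.val →
    lam (toSchedule.π (prevFin i)) ≤ lam (toSchedule.π i)
  h_lam_bound : ∀ i : Fin n, 0 < i.val →
    toSchedule.flow (toSchedule.π (prevFin i)) < 13 * lam (toSchedule.π i)
  h_lam_min : ∀ i : Fin n, 0 < i.val →
    (lam (toSchedule.π i) = lam (toSchedule.π (prevFin i)) ∨
      lam (toSchedule.π i) ≤ toSchedule.flow (toSchedule.π (prevFin i)))
  h_avail : ∀ i : Fin n, I.r (toSchedule.π i) ≤ dec (toSchedule.π i)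
  h_dec_start : ∀ i : Fin n,
    toSchedule.t (toSchedule.π i) =
      dec (toSchedule.π i) + (if toSchedule.startsBatch i then I.s else 0)
  h_no_idle : ∀ i : Fin n, 0 < i.val →
    toSchedule.c (toSchedule.π (prevFin i)) ≤ dec (toSchedule.π i) ∧
      (dec (toSchedule.π i) = toSchedule.c (toSchedule.π (prevFin i)) ∨
        ∀ k : Fin n, i ≤ k → dec (toSchedule.π i) ≤ I.r (toSchedule.π k))
  h_first_dec : ∀ h : 0 < n, ∀ j : Fin n, dec (toSchedule.π ⟨0, h⟩) ≤ I.r j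
  h_select : ∀ i k : Fin n, i < k →
    I.r (toSchedule.π k) ≤ dec (toSchedule.π i) →
    I.r (toSchedule.π i) +
        (if 0 < i.val ∧ I.τ (toSchedule.π i) = I.τ (toSchedule.π (prevFin i)) then 0
         else lam (toSchedule.π i))
      ≤ I.r (toSchedule.π k) +
        (if 0 < i.val ∧ I.τ (toSchedule.π k) = I.τ (toSchedule.π (prevFin i)) then 0
         else lam (toSchedule.π i))
  h_tie : ∀ i k : Fin n, i < k →
    I.r (toSchedule.π k) ≤ dec (toSchedule.π i) → 0 < i.val →
    (I.r (toSchedule.π i) +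
        (if I.τ (toSchedule.π i) = I.τ (toSchedule.π (prevFin i)) then 0
         else lam (toSchedule.π i))
      = I.r (toSchedule.π k) +
        (if I.τ (toSchedule.π k) = I.τ (toSchedule.π (prevFin i)) then 0
         else lam (toSchedule.π i))) →
    I.τ (toSchedule.π k) = I.τ (toSchedule.π (prevFin i)) →
    I.τ (toSchedule.π i) = I.τ (toSchedule.π (prevFin i))

namespace BalanceSchedule

variable {n : ℕ} {I : SInstance n}

/-- The job at position `i` belongs to the subschedule `S_{α^q}`, i.e. it was
scheduled while the balance parameter had value `α^q = 13^q`. -/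
def inS (B : BalanceSchedule I) (q : ℕ) (i : Fin n) : Prop :=
  B.lam (B.toSchedule.π i) = 13 ^ q

/-- Position `b` is the first position of the subschedule `S^δ_{α^q}`: it is the
last position of `S_{α^q}` that starts a batch and whose job has flow time at most
`(α − δ)·α^q`. -/
def IsSdStart (B : BalanceSchedule I) (q : ℕ) (δ : ℝ) (b : Fin n) : Prop :=
  B.inS q b ∧ B.toSchedule.startsBatch b ∧
    B.toSchedule.flow (B.toSchedule.π b) ≤ (13 - δ) * 13 ^ q ∧
    ∀ b' : Fin n, b < b' → B.inS q b' → B.toSchedule.startsBatch b' →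
      ¬ B.toSchedule.flow (B.toSchedule.π b') ≤ (13 - δ) * 13 ^ q

end BalanceSchedule

/-- A run of a greedy-like non-clairvoyant online algorithm `A` on instance `I`.
The algorithm is represented by the total orderings it determines: given the
history (the list of `(release time, type, processing time)` of the jobs completed
so far, in order of processing — processing times become known only on completion),
`A hist` is a total order on the descriptors `(release time, type)` of all possible
jobs.  The run never idles deliberately, performs a setup before the first job and
at every type change, and whenever the machine becomes idle it schedules, among the
already released yet unscheduled jobs, one that comes first in the current
ordering. -/
structure GreedyRun {n : ℕ}
    (A : List (ℝ × ℕ × ℝ) → (ℝ × ℕ) → (ℝ × ℕ) → Prop)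
    (I : SInstance n) extends Schedule I where
  dec : Fin n → ℝ
  h_avail : ∀ i : Fin n, I.r (toSchedule.π i) ≤ dec (toSchedule.π i)
  h_dec_start : ∀ i : Fin n,
    toSchedule.t (toSchedule.π i) =
      dec (toSchedule.π i) + (if toSchedule.startsBatch i then I.s else 0)
  h_no_idle : ∀ i : Fin n, 0 < i.val →
    toSchedule.c (toSchedule.π (prevFin i)) ≤ dec (toSchedule.π i) ∧
      (dec (toSchedule.π i) = toSchedule.c (toSchedule.π (prevFin i)) ∨
        ∀ k : Fin n, i ≤ k → dec (toSchedule.π i) ≤ I.r (toSchedule.π k))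
  h_first_dec : ∀ h : 0 < n, ∀ j : Fin n, dec (toSchedule.π ⟨0, h⟩) ≤ I.r j
  h_select : ∀ i k : Fin n, i < k →
    I.r (toSchedule.π k) ≤ dec (toSchedule.π i) →
    A (List.ofFn (fun m : Fin i.val =>
        (I.r (toSchedule.π ⟨m.val, lt_trans m.isLt i.isLt⟩),
         I.τ (toSchedule.π ⟨m.val, lt_trans m.isLt i.isLt⟩),
         I.p (toSchedule.π ⟨m.val, lt_trans m.isLt i.isLt⟩))))
      (I.r (toSchedule.π i), I.τ (toSchedule.π i))
      (I.r (toSchedule.π k), I.τ (toSchedule.π k))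


/-! ### Auxiliary material for the lower bound -/

/-- Type offset of the job with index `k` inside a round whose stream bit is `β`. -/
def lbt (β : Bool) (k : ℕ) : ℕ :=
  match k with
  | 0 => 0
  | 1 => 1
  | _ => β.toNat

/-- Release offset within a round. -/
def lbr (k : ℕ) : ℕ :=
  match k with
  | 0 => 0
  | 1 => 0
  | k => k

/-- The lower bound instance: `m` rounds of `m` jobs each. -/
noncomputable def lbInst (m : ℕ) (b : Fin m → Bool) : SInstance (m * m) where
  r j := ((j.divNat.val * (m + 2) + lbr j.modNat.val : ℕ) : ℝ)
  p _ := 1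
  τ j := 2 * j.divNat.val + lbt (b j.divNat) j.modNat.val
  s := 1
  hr _ := Nat.cast_nonneg _
  hs := zero_le_one

/-- Job with index `k` of round `i`. -/
def mkJob {m : ℕ} (i k : Fin m) : Fin (m * m) := finProdFinEquiv (i, k)

lemma mkJob_div {m : ℕ} (i k : Fin m) : (mkJob i k).divNat = i := by
  have := congrArg Prod.fst (finProdFinEquiv.symm_apply_apply (i, k))
  exact this

lemma mkJob_mod {m : ℕ} (i k : Fin m) : (mkJob i k).modNat = k := by
  have := congrArg Prod.snd (finProdFinEquiv.symm_apply_apply (i, k))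
  exact this

lemma job_ext {m : ℕ} {x y : Fin (m * m)} (h1 : x.divNat = y.divNat)
    (h2 : x.modNat = y.modNat) : x = y := by
  apply finProdFinEquiv.symm.injective
  simp [h1, h2]

lemma lbt_cases (β : Bool) (k : ℕ) :
    (k = 0 ∧ lbt β k = 0) ∨ (k = 1 ∧ lbt β k = 1) ∨ (2 ≤ k ∧ lbt β k = β.toNat) := by
  match k with
  | 0 => simp [lbt]
  | 1 => simp [lbt]
  | k + 2 => simp [lbt]

lemma lbr_cases (k : ℕ) :
    (k = 0 ∧ lbr k = 0) ∨ (k = 1 ∧ lbr k = 0) ∨ (2 ≤ k ∧ lbr k = k) := by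
  match k with
  | 0 => simp [lbr]
  | 1 => simp [lbr]
  | k + 2 => simp [lbr]

lemma toNat_cases (β : Bool) : (β = false ∧ β.toNat = 0) ∨ (β = true ∧ β.toNat = 1) := by
  cases β <;> simp

lemma lbt_le (β : Bool) (k : ℕ) : lbt β k ≤ 1 := by
  rcases lbt_cases β k with h | h | h <;> rcases toNat_cases β with h' | h' <;> omega

lemma lb_desc_inj {m : ℕ} (b : Fin m → Bool) (x y : Fin (m * m))
    (h1 : (lbInst m b).r x = (lbInst m b).r y) (h2 : (lbInst m b).τ x = (lbInst m b).τ y) :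
    x = y := by
  simp only [lbInst] at h1 h2
  have h1' := Nat.cast_injective (R := ℝ) h1
  have hx := lbt_le (b x.divNat) x.modNat.val
  have hy := lbt_le (b y.divNat) y.modNat.val
  have hd : x.divNat = y.divNat := Fin.ext (by omega)
  rw [hd] at h1' h2
  have h3 : lbr x.modNat.val = lbr y.modNat.val := by omega
  have h4 : lbt (b y.divNat) x.modNat.val = lbt (b y.divNat) y.modNat.val := by omega
  refine job_ext hd (Fin.ext ?_)
  rcases lbr_cases x.modNat.val with h | h | h <;>
  rcases lbr_cases y.modNat.val with h' | h' | h' <;>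
  rcases lbt_cases (b y.divNat) x.modNat.val with k | k | k <;>
  rcases lbt_cases (b y.divNat) y.modNat.val with k' | k' | k' <;> omega

section sched
variable {n : ℕ} {I : SInstance n}

lemma prevFin_val (i : Fin n) : (prevFin i).val = i.val - 1 := rfl

lemma sched_mono (S : Schedule I) (hp : ∀ j, I.p j = 1) :
    ∀ d : ℕ, ∀ q q' : Fin n, q'.val = q.val + d + 1 → S.t (S.π q) + 1 ≤ S.t (S.π q') := by
  intro d
  have step : ∀ q' : Fin n, 0 < q'.val → S.t (S.π (prevFin q')) + 1 ≤ S.t (S.π q') := by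
    intro q' h
    have := S.h_gap q' h
    rw [hp] at this
    have h0 := I.hs
    split_ifs at this <;> linarith
  induction d with
  | zero =>
    intro q q' h
    have h1 : prevFin q' = q := Fin.ext (by rw [prevFin_val]; omega)
    have := step q' (by omega)
    rwa [h1] at this
  | succ d ih =>
    intro q q' h
    have h2 := ih q (prevFin q') (by rw [prevFin_val]; omega)
    have := step q' (by omega)
    linarith

lemma sched_lt (S : Schedule I) (hp : ∀ j, I.p j = 1) {q q' : Fin n} (h : q < q') :
    S.t (S.π q) + 1 ≤ S.t (S.π q') :=
  sched_mono S hp (q'.val - q.val - 1) q q' (by have : q.val < q'.val := h; omega)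

lemma sched_count (S : Schedule I) (hp : ∀ j, I.p j = 1) (hs : I.s = 1) :
    ∀ d : ℕ, ∀ q : Fin n, q.val = d →
      (d : ℝ) + ((Finset.univ.filter (fun x : Fin n => x ≤ q ∧ S.startsBatch x)).card : ℝ)
        ≤ S.t (S.π q) := by
  intro d
  induction d with
  | zero =>
    intro q h
    have hn : 0 < n := by have := q.isLt; omega
    have hq : q = ⟨0, hn⟩ := Fin.ext h
    have h1 := S.h_first hn
    rw [hs] at h1
    have : (Finset.univ.filter (fun x : Fin n => x ≤ q ∧ S.startsBatch x)).card ≤ 1 := by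
      rw [Finset.card_le_one]
      intro x hx y hy
      simp only [Finset.mem_filter, Finset.mem_univ, true_and] at hx hy
      have a1 : x.val ≤ q.val := hx.1
      have a2 : y.val ≤ q.val := hy.1
      exact Fin.ext (by omega)
    have h2 : ((Finset.univ.filter (fun x : Fin n => x ≤ q ∧ S.startsBatch x)).card : ℝ) ≤ 1 := by
      exact_mod_cast this
    rw [← hq] at h1
    push_cast
    linarith
  | succ d ih =>
    intro q h
    have h2 := ih (prevFin q) (by rw [prevFin_val]; omega)
    have h3 := S.h_gap q (by omega)
    rw [hp, hs] at h3
    by_cases hb : S.startsBatch q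
    · have hsub : (Finset.univ.filter (fun x : Fin n => x ≤ q ∧ S.startsBatch x)) ⊆
          insert q (Finset.univ.filter (fun x : Fin n => x ≤ prevFin q ∧ S.startsBatch x)) := by
        intro x hx
        simp only [Finset.mem_insert, Finset.mem_filter, Finset.mem_univ, true_and] at hx ⊢
        by_cases hxq : x = q
        · exact Or.inl hxq
        · right
          refine ⟨?_, hx.2⟩
          have a1 : x.val ≤ q.val := hx.1
          have a2 : x.val ≠ q.val := fun e => hxq (Fin.ext e)
          show x.val ≤ (prevFin q).val
          rw [prevFin_val]; omega
      have hc := (Finset.card_le_card hsub).trans (Finset.card_insert_le _ _)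
      have hc' : ((Finset.univ.filter (fun x : Fin n => x ≤ q ∧ S.startsBatch x)).card : ℝ) ≤
        ((Finset.univ.filter (fun x : Fin n => x ≤ prevFin q ∧ S.startsBatch x)).card : ℝ) + 1 := by
        exact_mod_cast hc
      have hb' : I.τ (S.π (prevFin q)) ≠ I.τ (S.π q) := by
        rcases hb with h0 | h0
        · omega
        · exact h0
      rw [if_pos hb'] at h3
      push_cast
      linarith
    · have hsub : (Finset.univ.filter (fun x : Fin n => x ≤ q ∧ S.startsBatch x)) ⊆
          (Finset.univ.filter (fun x : Fin n => x ≤ prevFin q ∧ S.startsBatch x)) := by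
        intro x hx
        simp only [Finset.mem_filter, Finset.mem_univ, true_and] at hx ⊢
        refine ⟨?_, hx.2⟩
        have a1 : x.val ≤ q.val := hx.1
        have a2 : x.val ≠ q.val := fun e => hb ((Fin.ext e : x = q) ▸ hx.2)
        show x.val ≤ (prevFin q).val
        rw [prevFin_val]; omega
      have hc' : ((Finset.univ.filter (fun x : Fin n => x ≤ q ∧ S.startsBatch x)).card : ℝ) ≤
        ((Finset.univ.filter (fun x : Fin n => x ≤ prevFin q ∧ S.startsBatch x)).card : ℝ) := by
        exact_mod_cast Finset.card_le_card hsub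
      have : (0:ℝ) ≤ (if I.τ (S.π (prevFin q)) ≠ I.τ (S.π q) then (1:ℝ) else 0) := by
        split_ifs <;> norm_num
      push_cast
      linarith

lemma flow_le_max (S : Schedule I) (j : Fin n) : S.flow j ≤ S.maxFlow :=
  le_csSup (Set.finite_range _).bddAbove ⟨j, rfl⟩

/-- Between a position of another type and a position of type `τ0`, a `τ0` batch starts. -/
lemma start_between (S : Schedule I) (l q : Fin n) (hlq : l < q)
    (hl : I.τ (S.π l) ≠ I.τ (S.π q)) :
    ∃ x, l < x ∧ x ≤ q ∧ S.startsBatch x ∧ I.τ (S.π x) = I.τ (S.π q) := by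
  have hex : ∃ k : ℕ, ∃ h : k < n, l.val < k ∧ I.τ (S.π ⟨k, h⟩) = I.τ (S.π q) :=
    ⟨q.val, q.isLt, hlq, rfl⟩
  obtain ⟨hk, hlk, ht⟩ := Nat.find_spec hex
  have hmin := fun k => Nat.find_min (H := hex) (m := k)
  have hle : Nat.find hex ≤ q.val := Nat.find_le ⟨q.isLt, hlq, rfl⟩
  refine ⟨⟨Nat.find hex, hk⟩, hlk, hle, Or.inr ?_, ht⟩
  rw [ht]
  intro hc
  by_cases he : Nat.find hex = l.val + 1
  · apply hl
    rw [← hc]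
    congr 2
    refine Fin.ext ?_
    rw [prevFin_val]
    show l.val = Nat.find hex - 1
    omega
  · refine hmin (Nat.find hex - 1) (by omega) ⟨by omega, by omega, ?_⟩
    exact hc

lemma start_first (S : Schedule I) (q : Fin n) :
    ∃ x, x ≤ q ∧ S.startsBatch x ∧ I.τ (S.π x) = I.τ (S.π q) := by
  have hn : 0 < n := by have := q.isLt; omega
  by_cases h : I.τ (S.π ⟨0, hn⟩) = I.τ (S.π q)
  · exact ⟨⟨0, hn⟩, Nat.zero_le _, Or.inl rfl, h⟩
  · have hq : (⟨0, hn⟩ : Fin n) < q := by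
      refine lt_of_le_of_ne (Nat.zero_le _) (fun e => h (by rw [← e]))
    obtain ⟨x, _, h2, h3, h4⟩ := start_between S ⟨0, hn⟩ q hq h
    exact ⟨x, h2, h3, h4⟩

end sched

section coupling
variable {n : ℕ} {A : List (ℝ × ℕ × ℝ) → (ℝ × ℕ) → (ℝ × ℕ) → Prop}

lemma later_pos {n : ℕ} {π π' : Fin n ≃ Fin n} {q : Fin n} (h : ∀ x, x < q → π x = π' x) :
    ∃ k, q ≤ k ∧ π k = π' q := by
  refine ⟨π.symm (π' q), ?_, by simp⟩
  by_contra hlt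
  push Not at hlt
  have := h _ hlt
  rw [Equiv.apply_symm_apply] at this
  exact absurd (π'.injective this) (ne_of_gt hlt)

lemma dec_le {I I' : SInstance n} (hr : I.r = I'.r) (R : GreedyRun A I) (R' : GreedyRun A I')
    (q : Fin n) (hπ : ∀ x, x < q → R.π x = R'.π x)
    (hc : 0 < q.val → R.c (R.π (prevFin q)) = R'.c (R'.π (prevFin q))) :
    R.dec (R.π q) ≤ R'.dec (R'.π q) := by
  have hav := R'.h_avail q
  rw [← hr] at hav
  by_cases h0 : 0 < q.val
  · rcases (R.h_no_idle q h0).2 with h | h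
    · rw [h, hc h0]
      exact (R'.h_no_idle q h0).1
    · obtain ⟨k, hk, hk'⟩ := later_pos hπ
      have := h k hk
      rw [hk'] at this
      linarith
  · have hn : 0 < n := by have := q.isLt; omega
    have hq : q = ⟨0, hn⟩ := Fin.ext (by simp; omega)
    have := R.h_first_dec hn (R'.π q)
    rw [← hq] at this
    linarith

lemma couple (hA : ∀ hist, IsLinearOrder (ℝ × ℕ) (A hist))
    {I I' : SInstance n} (hr : I.r = I'.r) (hp : I.p = I'.p) (hs : I.s = I'.s)
    (hinj : ∀ x y, I.r x = I.r y → I.τ x = I.τ y → x = y)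
    (R : GreedyRun A I) (R' : GreedyRun A I') (d : ℕ) :
    ∀ q : Fin n, q.val = d →
      (∀ x, x ≤ q → I.τ (R.π x) = I'.τ (R.π x) ∧ I.τ (R'.π x) = I'.τ (R'.π x)) →
      R.π q = R'.π q ∧ R.dec (R.π q) = R'.dec (R'.π q) := by
  induction d using Nat.strong_induction_on with
  | _ d ih =>
    intro q hq hτ
    have hprev : ∀ x, x < q → R.π x = R'.π x ∧ R.dec (R.π x) = R'.dec (R'.π x) := by
      intro x hx
      have hx' : x.val < q.val := hx
      exact ih x.val (by omega) x rfl (fun y hy => hτ y (hy.trans hx.le))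
    have hπ : ∀ x, x < q → R.π x = R'.π x := fun x hx => (hprev x hx).1
    have hst : ∀ x, x < q → (R.startsBatch x ↔ R'.startsBatch x) := by
      intro x hx
      have hpx : prevFin x ≤ x := by show (prevFin x).val ≤ x.val; rw [prevFin_val]; omega
      have h1 := (hτ x hx.le).1
      have h2 := (hτ (prevFin x) (hpx.trans hx.le)).1
      unfold Schedule.startsBatch
      rw [← hπ x hx, ← hπ (prevFin x) (lt_of_le_of_lt hpx hx), h1, h2]
    have hc : 0 < q.val → R.c (R.π (prevFin q)) = R'.c (R'.π (prevFin q)) := by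
      intro h0
      have hlt : prevFin q < q := by show (prevFin q).val < q.val; rw [prevFin_val]; omega
      have e1 := R.h_dec_start (prevFin q)
      have e2 := R'.h_dec_start (prevFin q)
      have e3 := hst _ hlt
      have e4 := (hprev _ hlt).2
      have e5 := hπ _ hlt
      unfold Schedule.c
      rw [e1, e2, e4, hs, hp, e5]
      by_cases hb : R'.startsBatch (prevFin q)
      · rw [if_pos hb, if_pos (e3.2 hb)]
      · rw [if_neg hb, if_neg (fun h => hb (e3.1 h))]
    have hdec : R.dec (R.π q) = R'.dec (R'.π q) :=
      le_antisymm (dec_le hr R R' q hπ hc)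
        (dec_le hr.symm R' R q (fun x hx => (hπ x hx).symm) (fun h => (hc h).symm))
    refine ⟨?_, hdec⟩
    by_contra hne
    obtain ⟨k, hk, hk'⟩ := later_pos hπ
    obtain ⟨l, hl, hl'⟩ := later_pos (fun x hx => (hπ x hx).symm)
    have hkq : q < k := lt_of_le_of_ne hk (fun e => hne (by rw [← hk', ← e]))
    have hlq : q < l := lt_of_le_of_ne hl (fun e => hne (by rw [← hl', ← e]))
    have s1 := R.h_select q k hkq (by rw [hk', hdec, hr]; exact R'.h_avail q)
    have s2 := R'.h_select q l hlq (by rw [hl', ← hdec, ← hr]; exact R.h_avail q)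
    rw [hk'] at s1
    rw [hl'] at s2
    have hist : (List.ofFn (fun m : Fin q.val =>
        (I'.r (R'.π ⟨m.val, lt_trans m.isLt q.isLt⟩),
         I'.τ (R'.π ⟨m.val, lt_trans m.isLt q.isLt⟩),
         I'.p (R'.π ⟨m.val, lt_trans m.isLt q.isLt⟩)))) =
        (List.ofFn (fun m : Fin q.val =>
        (I.r (R.π ⟨m.val, lt_trans m.isLt q.isLt⟩),
         I.τ (R.π ⟨m.val, lt_trans m.isLt q.isLt⟩),
         I.p (R.π ⟨m.val, lt_trans m.isLt q.isLt⟩)))) := by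
      congr 1
      funext z
      have hz : (⟨z.val, lt_trans z.isLt q.isLt⟩ : Fin n) < q := z.isLt
      rw [← hπ _ hz, (hτ _ hz.le).1, hr, hp]
    rw [hist, ← hr, ← (hτ q le_rfl).1, ← (hτ q le_rfl).2] at s2
    have := (hA (List.ofFn (fun m : Fin q.val =>
        (I.r (R.π ⟨m.val, lt_trans m.isLt q.isLt⟩),
         I.τ (R.π ⟨m.val, lt_trans m.isLt q.isLt⟩),
         I.p (R.π ⟨m.val, lt_trans m.isLt q.isLt⟩))))).antisymm _ _ s1 s2
    simp only [Prod.mk.injEq] at this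
    exact hne (hinj _ _ this.1 this.2)

end coupling

/-- Start offset (within a round) of the position `k` in the good schedule. -/
def lbg (k : ℕ) : ℕ :=
  match k with
  | 0 => 1
  | k + 1 => k + 3

lemma lbg_cases (k : ℕ) : (k = 0 ∧ lbg k = 1) ∨ (1 ≤ k ∧ lbg k = k + 2) := by
  match k with
  | 0 => simp [lbg]
  | k + 1 => simp [lbg]

lemma prev_divmod {m : ℕ} (q : Fin (m * m)) (h : 0 < q.val) :
    (1 ≤ q.modNat.val ∧ (prevFin q).divNat.val = q.divNat.val ∧
      (prevFin q).modNat.val + 1 = q.modNat.val) ∨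
    (q.modNat.val = 0 ∧ (prevFin q).divNat.val + 1 = q.divNat.val ∧
      (prevFin q).modNat.val + 1 = m) := by
  have hm : 0 < m := by
    rcases Nat.eq_zero_or_pos m with h0 | h0
    · subst h0; exact absurd q.isLt (by simp)
    · exact h0
  simp only [Fin.coe_divNat, Fin.coe_modNat, prevFin_val]
  have e := Nat.div_add_mod q.val m
  have hlt := Nat.mod_lt q.val hm
  by_cases h0 : q.val % m = 0
  · right
    have hq : 0 < q.val / m := by
      rcases Nat.eq_zero_or_pos (q.val / m) with h1 | h1
      · rw [h1, h0] at e; omega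
      · exact h1
    obtain ⟨d, hd⟩ : ∃ d, q.val / m = d + 1 := ⟨q.val / m - 1, by omega⟩
    have e2 : q.val - 1 = m * d + (m - 1) := by
      rw [hd, h0, Nat.mul_add] at e
      omega
    refine ⟨h0, ?_, ?_⟩
    · rw [e2, Nat.mul_add_div hm, Nat.div_eq_of_lt (by omega), hd, Nat.add_zero]
    · rw [e2, Nat.mul_add_mod, Nat.mod_eq_of_lt (by omega)]; omega
  · left
    have e2 : q.val - 1 = m * (q.val / m) + (q.val % m - 1) := by omega
    refine ⟨by omega, ?_, ?_⟩
    · rw [e2, Nat.mul_add_div hm, Nat.div_eq_of_lt (a := q.val % m - 1) (by omega), Nat.add_zero]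
    · rw [e2, Nat.mul_add_mod, Nat.mod_eq_of_lt (by omega)]; omega

/-- Processing order of the good schedule. -/
noncomputable def lbPerm {m : ℕ} (hm : 3 ≤ m) (b : Fin m → Bool) : Fin (m * m) ≃ Fin (m * m) :=
  finProdFinEquiv.symm.trans
    ((Equiv.prodShear (Equiv.refl (Fin m)) (fun i => bif b i then Equiv.refl (Fin m) else
      Equiv.swap (⟨0, by omega⟩ : Fin m) ⟨1, by omega⟩)).trans finProdFinEquiv)

lemma lbPerm_apply {m : ℕ} (hm : 3 ≤ m) (b : Fin m → Bool) (q : Fin (m * m)) :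
    lbPerm hm b q = mkJob q.divNat ((bif b q.divNat then Equiv.refl (Fin m) else
      Equiv.swap (⟨0, by omega⟩ : Fin m) ⟨1, by omega⟩) q.modNat) := rfl

lemma lbPerm_div {m : ℕ} (hm : 3 ≤ m) (b : Fin m → Bool) (q : Fin (m * m)) :
    (lbPerm hm b q).divNat = q.divNat := by
  rw [lbPerm_apply, mkJob_div]

lemma lbPerm_mod {m : ℕ} (hm : 3 ≤ m) (b : Fin m → Bool) (q : Fin (m * m)) :
    (b q.divNat = true ∧ (lbPerm hm b q).modNat.val = q.modNat.val) ∨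
    (b q.divNat = false ∧
      ((q.modNat.val = 0 ∧ (lbPerm hm b q).modNat.val = 1) ∨
       (q.modNat.val = 1 ∧ (lbPerm hm b q).modNat.val = 0) ∨
       (2 ≤ q.modNat.val ∧ (lbPerm hm b q).modNat.val = q.modNat.val))) := by
  rw [lbPerm_apply, mkJob_mod]
  cases hb : b q.divNat
  · right
    refine ⟨rfl, ?_⟩
    simp only [cond_false]
    by_cases h0 : q.modNat.val = 0
    · have : q.modNat = (⟨0, by omega⟩ : Fin m) := Fin.ext h0
      left
      refine ⟨h0, ?_⟩
      rw [this, Equiv.swap_apply_left]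
    · by_cases h1 : q.modNat.val = 1
      · have : q.modNat = (⟨1, by omega⟩ : Fin m) := Fin.ext h1
        right; left
        refine ⟨h1, ?_⟩
        rw [this, Equiv.swap_apply_right]
      · right; right
        refine ⟨by omega, ?_⟩
        rw [Equiv.swap_apply_of_ne_of_ne]
        · exact fun e => h0 (congrArg Fin.val e)
        · exact fun e => h1 (congrArg Fin.val e)
  · left
    simp

lemma exists_good_schedule {m : ℕ} (hm : 3 ≤ m) (b : Fin m → Bool) :
    ∃ S : Schedule (lbInst m b), S.maxFlow ≤ 4 := by
  have hmm : 0 < m * m := by positivity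
  let g : Fin (m * m) → ℝ := fun q => ((q.divNat.val * (m + 2) + lbg q.modNat.val : ℕ) : ℝ)
  refine ⟨⟨lbPerm hm b, fun j => g ((lbPerm hm b).symm j), ?_, ?_, ?_⟩, ?_⟩
  · intro j
    obtain ⟨q, rfl⟩ := (lbPerm hm b).surjective j
    simp only [Equiv.symm_apply_apply, lbInst, g]
    rw [lbPerm_div]
    apply Nat.cast_le.2
    rcases lbPerm_mod hm b q with h | ⟨_, h | h | h⟩ <;>
    rcases lbg_cases q.modNat.val with h' | h' <;>
    rcases lbr_cases (lbPerm hm b q).modNat.val with h'' | h'' | h'' <;> omega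
  · intro h
    simp only [Equiv.symm_apply_apply, lbInst, g]
    norm_cast
    rcases lbg_cases (⟨0, h⟩ : Fin (m * m)).modNat.val with h' | h' <;> omega
  · intro q hq
    have hδ : ∀ δ : ℝ, δ ≤ 1 → ((lbInst m b).τ (lbPerm hm b (prevFin q)) =
        (lbInst m b).τ (lbPerm hm b q) → δ = 0) → g (prevFin q) + 1 + δ ≤ g q := by
      intro δ hδ1 hδ0
      simp only [lbInst, lbPerm_div] at hδ0
      simp only [g]
      rcases prev_divmod q hq with ⟨h1, h2, h3⟩ | ⟨h1, h2, h3⟩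
      · have h2' : (prevFin q).divNat = q.divNat := Fin.ext h2
        rw [h2'] at hδ0 ⊢
        by_cases h4 : q.modNat.val = 1
        · have : (q.divNat.val * (m + 2) + lbg (prevFin q).modNat.val) + 1 + 1 ≤
              q.divNat.val * (m + 2) + lbg q.modNat.val := by
            rcases lbg_cases q.modNat.val with h' | h' <;>
            rcases lbg_cases (prevFin q).modNat.val with h'' | h'' <;> omega
          have h5 : (((q.divNat.val * (m + 2) + lbg (prevFin q).modNat.val : ℕ) : ℝ)) + 1 + 1 ≤
              ((q.divNat.val * (m + 2) + lbg q.modNat.val : ℕ) : ℝ) := by exact_mod_cast this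
          linarith
        · rw [hδ0]
          · have : (q.divNat.val * (m + 2) + lbg (prevFin q).modNat.val) + 1 ≤
              q.divNat.val * (m + 2) + lbg q.modNat.val := by
              rcases lbg_cases q.modNat.val with h' | h' <;>
              rcases lbg_cases (prevFin q).modNat.val with h'' | h'' <;> omega
            have h5 : (((q.divNat.val * (m + 2) + lbg (prevFin q).modNat.val : ℕ) : ℝ)) + 1 ≤
              ((q.divNat.val * (m + 2) + lbg q.modNat.val : ℕ) : ℝ) := by exact_mod_cast this
            linarith
          · have p1 := lbPerm_mod hm b q
            have p2 := lbPerm_mod hm b (prevFin q)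
            rw [h2'] at p2
            rcases toNat_cases (b q.divNat) with t | t <;>
            rcases lbt_cases (b q.divNat) (lbPerm hm b q).modNat.val with l | l | l <;>
            rcases lbt_cases (b q.divNat) (lbPerm hm b (prevFin q)).modNat.val with
              l' | l' | l' <;>
            rw [t.1] at p1 p2 <;>
            simp only [reduceCtorEq, false_and, true_and, or_false, false_or] at p1 p2 <;> omega
      · have : ((prevFin q).divNat.val * (m + 2) + lbg (prevFin q).modNat.val) + 1 + 1 ≤
              q.divNat.val * (m + 2) + lbg q.modNat.val := by
          rw [← h2, Nat.add_mul]
          rcases lbg_cases q.modNat.val with h' | h' <;>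
          rcases lbg_cases (prevFin q).modNat.val with h'' | h'' <;> omega
        have h5 : ((((prevFin q).divNat.val * (m + 2) +
              lbg (prevFin q).modNat.val : ℕ) : ℝ)) + 1 + 1 ≤
              ((q.divNat.val * (m + 2) + lbg q.modNat.val : ℕ) : ℝ) := by exact_mod_cast this
        linarith
    have hs : (lbInst m b).s = 1 := rfl
    have hp : (lbInst m b).p (lbPerm hm b (prevFin q)) = 1 := rfl
    rw [Equiv.symm_apply_apply, Equiv.symm_apply_apply, hs, hp]
    apply hδ
    · split_ifs <;> norm_num
    · intro e
      rw [if_neg (not_not.2 e)]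
  · have : Nonempty (Fin (m * m)) := ⟨⟨0, hmm⟩⟩
    refine csSup_le (Set.range_nonempty _) ?_
    rintro _ ⟨j, rfl⟩
    obtain ⟨q, rfl⟩ := (lbPerm hm b).surjective j
    simp only [Schedule.flow, Schedule.c, Equiv.symm_apply_apply, lbInst, g]
    rw [lbPerm_div]
    have : (q.divNat.val * (m + 2) + lbg q.modNat.val) + 1 ≤
        4 + (q.divNat.val * (m + 2) + lbr (lbPerm hm b q).modNat.val) := by
      rcases lbPerm_mod hm b q with h | ⟨_, h | h | h⟩ <;>
      rcases lbg_cases q.modNat.val with h' | h' <;>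
      rcases lbr_cases (lbPerm hm b q).modNat.val with h'' | h'' | h'' <;> omega
    have h5 : ((q.divNat.val * (m + 2) + lbg q.modNat.val : ℕ) : ℝ) + 1 ≤
        4 + ((q.divNat.val * (m + 2) + lbr (lbPerm hm b q).modNat.val : ℕ) : ℝ) := by
      exact_mod_cast this
    linarith

/-- The job of round `i` whose type is not the stream type. -/
def cJob {m : ℕ} (hm : 3 ≤ m) (i : Fin m) (β : Bool) : Fin (m * m) :=
  mkJob i ⟨1 - β.toNat, by omega⟩

/-- Round `i` is good: some stream type job is processed before the special job. -/
def goodRound {m : ℕ} (hm : 3 ≤ m) {b : Fin m → Bool} (S : Schedule (lbInst m b))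
    (i : Fin m) : Prop :=
  ∃ q qc, q < qc ∧ S.π qc = cJob hm i (b i) ∧
    (lbInst m b).τ (S.π q) = 2 * i.val + (b i).toNat

lemma τ_round {m : ℕ} {b : Fin m → Bool} {j : Fin (m * m)} {i : Fin m} {e : ℕ} (he : e ≤ 1)
    (h : (lbInst m b).τ j = 2 * i.val + e) : j.divNat = i := by
  simp only [lbInst] at h
  have := lbt_le (b j.divNat) j.modNat.val
  exact Fin.ext (by omega)

lemma τ_cJob {m : ℕ} (hm : 3 ≤ m) (b : Fin m → Bool) (i : Fin m) (β : Bool) :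
    (lbInst m b).τ (cJob hm i β) = 2 * i.val + (1 - β.toNat) := by
  simp only [lbInst, cJob, mkJob_div, mkJob_mod]
  cases β <;> rfl

lemma round_starts {m : ℕ} (hm : 3 ≤ m) {b : Fin m → Bool} (S : Schedule (lbInst m b))
    (hS : S.maxFlow < m) (i : Fin m) :
    2 + (if goodRound hm S i then 1 else 0) ≤
      (Finset.univ.filter (fun x => S.startsBatch x ∧ (S.π x).divNat = i)).card := by
  have hb1 : (b i).toNat ≤ 1 := by rcases toNat_cases (b i) with h | h <;> omega
  set qc := S.π.symm (cJob hm i (b i)) with hqc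
  have hπc : S.π qc = cJob hm i (b i) := by simp [hqc]
  let lst : Fin (m * m) := mkJob i ⟨m - 1, by omega⟩
  have hτl : (lbInst m b).τ lst = 2 * i.val + (b i).toNat := by
    simp only [lbInst, lst, mkJob_div, mkJob_mod]
    rcases lbt_cases (b i) (m - 1) with h | h | h <;> omega
  have hτc := τ_cJob hm b i (b i)
  set ql := S.π.symm lst with hql
  have hπl : S.π ql = lst := by simp [hql]
  have hlt : qc < ql := by
    by_contra hle
    push Not at hle
    have hne : ql ≠ qc := by
      intro e
      have : lst = cJob hm i (b i) := by rw [← hπl, ← hπc, e]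
      rw [this, hτc] at hτl
      omega
    have h1 := sched_lt S (fun _ => rfl) (lt_of_le_of_ne hle hne)
    rw [hπl, hπc] at h1
    have h2 := S.h_release lst
    have h3 := flow_le_max S (cJob hm i (b i))
    unfold Schedule.flow Schedule.c at h3
    have h4 : (lbInst m b).p (cJob hm i (b i)) = 1 := rfl
    have h5 : (lbInst m b).r lst = ((i.val * (m + 2) + (m - 1) : ℕ) : ℝ) := by
      simp only [lbInst, lst, mkJob_div, mkJob_mod]
      congr 2
      rcases lbr_cases (m - 1) with h | h | h <;> omega
    have h6 : (lbInst m b).r (cJob hm i (b i)) = ((i.val * (m + 2) : ℕ) : ℝ) := by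
      simp only [lbInst, cJob, mkJob_div, mkJob_mod]
      congr 1
      rcases lbr_cases (1 - (b i).toNat) with h | h | h <;> omega
    rw [h5] at h2
    rw [h4, h6] at h3
    have h7 : ((i.val * (m + 2) + (m - 1) : ℕ) : ℝ) + 1 = ((i.val * (m + 2) : ℕ) : ℝ) + m := by
      have : i.val * (m + 2) + (m - 1) + 1 = i.val * (m + 2) + m := by omega
      exact_mod_cast this
    linarith
  obtain ⟨y, hy1, hy2, hy3⟩ := start_first S qc
  obtain ⟨z, hz1, hz2, hz3, hz4⟩ := start_between S qc ql hlt (by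
    rw [hπc, hπl, hτc, hτl]; omega)
  rw [hπc, hτc] at hy3
  rw [hπl, hτl] at hz4
  have hyd := τ_round (by omega) hy3
  have hzd := τ_round hb1 hz4
  have hyz : y ≠ z := by
    intro e; rw [e] at hy3; omega
  split_ifs with hg
  · obtain ⟨q, qc', h1, h2, h3⟩ := hg
    have : qc' = qc := S.π.injective (by rw [h2, hπc])
    subst this
    obtain ⟨x, hx1, hx2, hx3⟩ := start_first S q
    rw [h3] at hx3
    have hxd := τ_round hb1 hx3
    refine Finset.two_lt_card.2 ⟨x, ?_, y, ?_, z, ?_, ?_, ?_, hyz⟩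
    · simp [hx2, hxd]
    · simp [hy2, hyd]
    · simp [hz3, hzd]
    · intro e; rw [e] at hx3; omega
    · exact ne_of_lt (lt_of_le_of_lt hx1 (h1.trans hz1))
  · refine Finset.one_lt_card.2 ⟨y, ?_, z, ?_, hyz⟩
    · simp [hy2, hyd]
    · simp [hz3, hzd]

lemma good_card_le {m : ℕ} (hm : 3 ≤ m) {b : Fin m → Bool} (S : Schedule (lbInst m b))
    (hS : S.maxFlow < m) :
    ((∑ i : Fin m, if goodRound hm S i then 1 else 0 : ℕ) : ℝ) ≤ S.maxFlow := by
  have hmm : 0 < m * m := by positivity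
  let last : Fin (m * m) := ⟨m * m - 1, by omega⟩
  have hc := sched_count S (fun _ => rfl) rfl (m * m - 1) last rfl
  have hcard : 2 * m + (∑ i : Fin m, if goodRound hm S i then 1 else 0) ≤
      (Finset.univ.filter (fun x : Fin (m * m) => x ≤ last ∧ S.startsBatch x)).card := by
    rw [Finset.card_eq_sum_card_fiberwise (f := fun x => (S.π x).divNat) (t := Finset.univ)
      (fun _ _ => Finset.mem_coe.2 (Finset.mem_univ _))]
    have : 2 * m + (∑ i : Fin m, if goodRound hm S i then 1 else 0) =
        ∑ i : Fin m, (2 + if goodRound hm S i then 1 else 0) := by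
      rw [Finset.sum_add_distrib]; simp; ring
    rw [this]
    refine Finset.sum_le_sum (fun i _ => (round_starts hm S hS i).trans (Finset.card_le_card ?_))
    intro x hx
    simp only [Finset.mem_filter, Finset.mem_univ, true_and] at hx ⊢
    refine ⟨⟨?_, hx.1⟩, hx.2⟩
    show x.val ≤ m * m - 1
    have := x.isLt
    omega
  have hf := flow_le_max S (S.π last)
  unfold Schedule.flow Schedule.c at hf
  have hp : (lbInst m b).p (S.π last) = 1 := rfl
  have hr : (lbInst m b).r (S.π last) ≤ ((m * m + 2 * m : ℕ) : ℝ) := by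
    simp only [lbInst]
    apply Nat.cast_le.2
    have h1 := (S.π last).divNat.isLt
    have h2 := (S.π last).modNat.isLt
    have h3 : ((S.π last).divNat.val + 1) * (m + 2) ≤ m * (m + 2) := Nat.mul_le_mul_right _ h1
    rcases lbr_cases (S.π last).modNat.val with h | h | h <;> nlinarith
  have hN : m * m + 2 * m + (∑ i : Fin m, if goodRound hm S i then 1 else 0) ≤
     (m * m - 1) + 1 +
      (Finset.univ.filter (fun x : Fin (m * m) => x ≤ last ∧ S.startsBatch x)).card := by omega
  have hN' : ((m * m + 2 * m : ℕ) : ℝ) +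
      ((∑ i : Fin m, if goodRound hm S i then 1 else 0 : ℕ) : ℝ) ≤
     ((m * m - 1 : ℕ) : ℝ) + 1 +
      ((Finset.univ.filter (fun x : Fin (m * m) => x ≤ last ∧ S.startsBatch x)).card : ℝ) := by
    exact_mod_cast hN
  rw [hp] at hf
  linarith

lemma not_both_bad_aux {m : ℕ} (hm : 3 ≤ m)
    {A : List (ℝ × ℕ × ℝ) → (ℝ × ℕ) → (ℝ × ℕ) → Prop}
    (hA : ∀ hist, IsLinearOrder (ℝ × ℕ) (A hist)) (b b' : Fin m → Bool) (i : Fin m)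
    (hi : b' i = !b i) (hne : ∀ k, k ≠ i → b' k = b k)
    (R : GreedyRun A (lbInst m b)) (R' : GreedyRun A (lbInst m b'))
    (h : ¬ goodRound hm R.toSchedule i) (h' : ¬ goodRound hm R'.toSchedule i)
    (hle : R.π.symm (cJob hm i (b i)) ≤ R'.π.symm (cJob hm i (b' i))) : False := by
  have hbn : (b' i).toNat = 1 - (b i).toNat := by rw [hi]; cases b i <;> rfl
  have hb1 : (b i).toNat ≤ 1 := by rcases toNat_cases (b i) with h | h <;> omega
  have hdiff : ∀ j : Fin (m * m), (lbInst m b).τ j ≠ (lbInst m b').τ j →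
      (lbInst m b).τ j = 2 * i.val + (b i).toNat ∧
      (lbInst m b').τ j = 2 * i.val + (b' i).toNat ∧ 2 ≤ j.modNat.val := by
    intro j hj
    simp only [lbInst] at hj ⊢
    have hji : j.divNat = i := by
      by_contra hc
      exact hj (by rw [hne _ hc])
    rw [hji] at hj ⊢
    rcases lbt_cases (b i) j.modNat.val with h | h | h <;>
    rcases lbt_cases (b' i) j.modNat.val with h' | h' | h' <;> omega
  have hcmod : ∀ β : Bool, (cJob hm i β).modNat.val ≤ 1 := by
    intro β
    rw [cJob, mkJob_mod]
    show 1 - β.toNat ≤ 1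
    omega
  set qc := R.π.symm (cJob hm i (b i)) with hqc
  have hπ : R.π qc = cJob hm i (b i) := by simp [hqc]
  set qc' := R'.π.symm (cJob hm i (b' i)) with hqc'
  have hπ' : R'.π qc' = cJob hm i (b' i) := by simp [hqc']
  have key := couple hA (I := lbInst m b) (I' := lbInst m b') rfl rfl rfl (lb_desc_inj b) R R'
    qc.val qc rfl (by
      intro x hx
      constructor
      · by_contra hc
        obtain ⟨h1, h2, h3⟩ := hdiff _ hc
        rcases hx.lt_or_eq with hlt | heq
        · exact h ⟨x, qc, hlt, hπ, h1⟩
        · rw [heq, hπ] at h3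
          have := hcmod (b i)
          omega
      · by_contra hc
        obtain ⟨h1, h2, h3⟩ := hdiff _ hc
        rcases (hx.trans hle).lt_or_eq with hlt | heq
        · exact h' ⟨x, qc', hlt, hπ', h2⟩
        · rw [heq, hπ'] at h3
          have := hcmod (b' i)
          omega)
  have e := key.1
  rw [hπ] at e
  have t1 : (lbInst m b').τ (R'.π qc) = 2 * i.val + (b' i).toNat := by
    rw [← e, τ_cJob, hbn]
  rcases hle.lt_or_eq with hlt | heq
  · exact h' ⟨qc, qc', hlt, hπ', t1⟩
  · rw [heq, hπ', τ_cJob] at t1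
    omega

lemma not_both_bad {m : ℕ} (hm : 3 ≤ m)
    {A : List (ℝ × ℕ × ℝ) → (ℝ × ℕ) → (ℝ × ℕ) → Prop}
    (hA : ∀ hist, IsLinearOrder (ℝ × ℕ) (A hist)) (b b' : Fin m → Bool) (i : Fin m)
    (hi : b' i = !b i) (hne : ∀ k, k ≠ i → b' k = b k)
    (R : GreedyRun A (lbInst m b)) (R' : GreedyRun A (lbInst m b')) :
    goodRound hm R.toSchedule i ∨ goodRound hm R'.toSchedule i := by
  by_contra hc
  push Not at hc
  rcases le_total (R.π.symm (cJob hm i (b i))) (R'.π.symm (cJob hm i (b' i))) with hle | hle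
  · exact not_both_bad_aux hm hA b b' i hi hne R R' hc.1 hc.2 hle
  · exact not_both_bad_aux hm hA b' b i (by simp [hi]) (fun k hk => (hne k hk).symm)
      R' R hc.2 hc.1 hle

/-- Flip the `i`-th bit. -/
def flipBit {m : ℕ} (i : Fin m) (b : Fin m → Bool) : Fin m → Bool :=
  fun k => if k = i then !b k else b k

lemma flipBit_inv {m : ℕ} (i : Fin m) : Function.Involutive (flipBit i) := by
  intro b
  funext k
  unfold flipBit
  split_ifs <;> simp

lemma averaging {m : ℕ} (f : (Fin m → Bool) → Fin m → ℕ)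
    (hf : ∀ b i, 1 ≤ f b i + f (flipBit i b) i) :
    ∃ b, m ≤ 2 * ∑ i, f b i := by
  by_contra hc
  push Not at hc
  have h1 : ∀ i, Fintype.card (Fin m → Bool) ≤ 2 * ∑ b, f b i := by
    intro i
    have e : ∑ b, f (flipBit i b) i = ∑ b, f b i :=
      Equiv.sum_comp (flipBit_inv i).toPerm (fun b => f b i)
    calc Fintype.card (Fin m → Bool) = ∑ b : Fin m → Bool, 1 := by simp
      _ ≤ ∑ b, (f b i + f (flipBit i b) i) := Finset.sum_le_sum (fun b _ => hf b i)
      _ = 2 * ∑ b, f b i := by rw [Finset.sum_add_distrib, e]; ring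
  have h2 : ∑ i : Fin m, Fintype.card (Fin m → Bool) ≤ ∑ i, 2 * ∑ b, f b i :=
    Finset.sum_le_sum (fun i _ => h1 i)
  have h3 : ∑ b : Fin m → Bool, 2 * ∑ i, f b i < ∑ b : Fin m → Bool, m :=
    Finset.sum_lt_sum_of_nonempty Finset.univ_nonempty (fun b _ => hc b)
  rw [← Finset.mul_sum, Finset.sum_comm] at h2
  rw [← Finset.mul_sum] at h3
  rw [Finset.sum_const] at h2 h3
  simp only [Finset.card_univ, smul_eq_mul, Fintype.card_fin] at h2 h3
  rw [Nat.mul_comm] at h3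
  rw [mul_comm m] at h2
  linarith

/-- Theorem 4: every greedy-like (non-clairvoyant online) algorithm
is `Ω(√n)`-competitive: there is a constant `c > 0` such that for every greedy-like
algorithm and every `N` there are instances with `n ≥ N` jobs and setup time
`s = 1` on which the maximum flow time of the algorithm is at least `c·√n` times
the optimal maximum flow time. -/
theorem greedy_like_lower_bound :
    ∃ c : ℝ, 0 < c ∧
      ∀ A : List (ℝ × ℕ × ℝ) → (ℝ × ℕ) → (ℝ × ℕ) → Prop,
        (∀ hist, IsLinearOrder (ℝ × ℕ) (A hist)) →
        ∀ N : ℕ, ∃ n : ℕ, N ≤ n ∧ ∃ I : SInstance n,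
          I.s = 1 ∧ (∀ j, 1 ≤ I.p j) ∧
          ∀ (R : GreedyRun A I) (O : Schedule I), O.IsOptimal →
            c * Real.sqrt n * O.maxFlow ≤ R.toSchedule.maxFlow := by
  refine ⟨1 / 8, by norm_num, ?_⟩
  intro A hA N
  have hm : 3 ≤ N + 3 := by omega
  generalize hmN : N + 3 = m at hm
  have hNm : N ≤ m * m := by nlinarith
  refine ⟨m * m, hNm, ?_⟩
  by_contra hcon
  have hbad : ∀ b : Fin m → Bool, ∃ R : GreedyRun A (lbInst m b),
      R.toSchedule.maxFlow < (m : ℝ) / 2 := by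
    intro b
    by_contra hb
    push Not at hb
    refine hcon ⟨lbInst m b, rfl, fun _ => le_rfl, fun R O hO => ?_⟩
    obtain ⟨S, hS⟩ := exists_good_schedule hm b
    have h1 : O.maxFlow ≤ 4 := (hO S).trans hS
    have h2 : Real.sqrt ((m * m : ℕ) : ℝ) = m := by
      rw [Nat.cast_mul]
      exact Real.sqrt_mul_self (Nat.cast_nonneg _)
    rw [h2]
    have h3 := hb R
    have h4 : (0 : ℝ) ≤ m := Nat.cast_nonneg _
    nlinarith
  choose R hR using hbad
  have hm0 : (0 : ℝ) < m := by
    have : 0 < m := by omega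
    exact_mod_cast this
  obtain ⟨b, hb⟩ := averaging
    (fun b i => if goodRound hm (R b).toSchedule i then 1 else 0) (by
      intro b i
      have := not_both_bad hm hA b (flipBit i b) i (by simp [flipBit])
        (fun k hk => by simp [flipBit, hk]) (R b) (R (flipBit i b))
      rcases this with h | h
      · simp only [if_pos h]; omega
      · simp only [if_pos h]; omega)
  have h1 := good_card_le hm (R b).toSchedule (by have := hR b; linarith)
  have h2 := hR b
  have h3 : (m : ℝ) ≤ 2 * ((∑ i : Fin m,
      if goodRound hm (R b).toSchedule i then 1 else 0 : ℕ) : ℝ) := by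
    exact_mod_cast hb
  linarith
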